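/- arXiv:2107.07835 — 4 statements merged into one kernel-verified Lean document; each statement's English description precedes it below -/
import Mathlib

section
/- Let K : [0,T] → ℝ be a kernel satisfying the standing kernel assumption with constants C > 0 and H > 0. Let (π_n)_{n≥1} be a sequence of partitions of [0,T] with associated step functions η_n. Let q ≥ 2 and C₀ > 0 be constants, and let (f_n)_{n≥1} be a sequence of nonnegative bounded measurable functions on [0,T] with sup_{n≥1} f_n(0) < ∞, such that for all n ≥ 1 and all 0 ≤ s ≤ t ≤ T: f_n(t) ≤ C₀(1 + f_n(s)) + C₀ ( ∫_s^t K(t − η_n(r))² (1 + f_n(η_n(r))^{2/q}) dr )^{q/2} + C₀ ( ∫_0^s |K(t − η_n(r)) − K(s − η_n(r))|² (1 + f_n(η_n(r))^{2/q}) dr )^{q/2}. Then sup_{n≥1} sup_{0 ≤ t ≤ T} f_n(t) < ∞. -/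
open MeasureTheory Set Filter

/-- A partition `0 = t_0 < t_1 < ... < t_n = T` of the interval `[0,T]`. -/
structure TimeGrid (T : ℝ) where
  n : ℕ
  t : ℕ → ℝ
  npos : 0 < n
  first : t 0 = 0
  last : t n = T
  strict : ∀ i < n, t i < t (i + 1)

/-- The step function `η` associated to a partition: `η(s) = t_k` for `s ∈ [t_k, t_{k+1})`,
`η(T) = T`. -/
noncomputable def TimeGrid.eta {T : ℝ} (π : TimeGrid T) (s : ℝ) : ℝ :=
  sSup {x | ∃ k ≤ π.n, π.t k = x ∧ x ≤ s}

/-- The mesh of a partition. -/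
noncomputable def TimeGrid.mesh {T : ℝ} (π : TimeGrid T) : ℝ :=
  sSup {d | ∃ k < π.n, d = π.t (k + 1) - π.t k}

/-- The standing kernel assumption with constants `C > 0`, `H > 0`: `K` is nonnegative,
non-increasing, continuous and square-integrable on `[0,T]`, and satisfies conditions
(A2) and (A3) for the step function of every partition of `[0,T]`. -/
def StandingKernel (T C H : ℝ) (K : ℝ → ℝ) : Prop :=
  (∀ u ∈ Icc 0 T, 0 ≤ K u) ∧
  (∀ u ∈ Icc 0 T, ∀ v ∈ Icc 0 T, u ≤ v → K v ≤ K u) ∧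
  ContinuousOn K (Icc 0 T) ∧
  IntegrableOn (fun u => K u ^ 2) (Icc 0 T) ∧
  ∀ π : TimeGrid T, ∀ t ∈ Icc 0 T, ∀ δ ∈ Ioc 0 (T - t),
    (∫ s in t..(t + δ), K (t + δ - π.eta s) ^ 2) ≤ C * δ ^ (2 * H) ∧
    (∫ s in (0:ℝ)..t, (K (t + δ - π.eta s) - K (t - π.eta s)) ^ 2) ≤ C * δ ^ (2 * H)

/-- Grid points are nondecreasing. -/
theorem TimeGrid.t_mono {T : ℝ} (π : TimeGrid T) {i j : ℕ} (hij : i ≤ j) (hj : j ≤ π.n) :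
    π.t i ≤ π.t j := by
  induction j, hij using Nat.le_induction with
  | base => exact le_rfl
  | succ j _ ih => exact (ih (by omega)).trans (π.strict j (by omega)).le

/-- Grid points are nonnegative. -/
theorem TimeGrid.t_nonneg {T : ℝ} (π : TimeGrid T) {i : ℕ} (hi : i ≤ π.n) : 0 ≤ π.t i :=
  π.first ▸ π.t_mono (Nat.zero_le i) hi

/-- Grid points are at most `T`. -/
theorem TimeGrid.t_le {T : ℝ} (π : TimeGrid T) {i : ℕ} (hi : i ≤ π.n) : π.t i ≤ T :=
  (π.t_mono hi le_rfl).trans π.last.le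

/-- The step function takes values in the grid points to the left of its argument. -/
theorem TimeGrid.exists_eta_eq {T : ℝ} (π : TimeGrid T) {r : ℝ} (hr : 0 ≤ r) :
    ∃ k ≤ π.n, π.t k = π.eta r ∧ π.eta r ≤ r := by
  have hfin : {x | ∃ k ≤ π.n, π.t k = x ∧ x ≤ r}.Finite := by
    refine ((Set.finite_Iic π.n).image π.t).subset ?_
    rintro x ⟨k, hk, hx, -⟩
    exact ⟨k, hk, hx⟩
  have hne : {x | ∃ k ≤ π.n, π.t k = x ∧ x ≤ r}.Nonempty :=
    ⟨0, 0, Nat.zero_le _, π.first, hr⟩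
  exact hne.csSup_mem hfin

/-- To prove a property on `[0,T]` it suffices to derive it at each time from its validity at
all strictly earlier grid points. -/
theorem TimeGrid.induction_on_grid {T : ℝ} (π : TimeGrid T) {P : ℝ → Prop}
    (h : ∀ t ∈ Icc (0:ℝ) T, (∀ i ≤ π.n, π.t i < t → P (π.t i)) → P t) :
    ∀ t ∈ Icc (0:ℝ) T, P t := by
  have hgrid : ∀ k ≤ π.n, P (π.t k) := by
    intro k
    induction k using Nat.strong_induction_on with
    | _ k ih =>
      intro hk
      refine h _ ⟨π.t_nonneg hk, π.t_le hk⟩ fun i hi hlt => ih i ?_ hi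
      by_contra! hki
      exact absurd (π.t_mono hki hi) (not_le.mpr hlt)
  exact fun t ht => h t ht fun i hi _ => hgrid i hi

/-- An exponential bound on `u` at earlier grid points bounds the discretized convolution. -/
theorem TimeGrid.integral_sq_mul_le {T : ℝ} (π : TimeGrid T) {K u : ℝ → ℝ} {κ a c t : ℝ}
    (hK0 : ∀ x ∈ Icc 0 T, 0 ≤ K x) (hKκ : ∀ x ∈ Icc 0 T, K x ≤ κ)
    (hu : ∀ x ∈ Icc 0 T, 0 ≤ u x) (ha : 0 ≤ a) (hc : 0 < c) (ht : t ∈ Icc (0:ℝ) T)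
    (h : ∀ i ≤ π.n, π.t i < t → u (π.t i) ≤ a * Real.exp (c * π.t i)) :
    0 ≤ ∫ r in (0:ℝ)..t, K (t - π.eta r) ^ 2 * u (π.eta r) ∧
    ∫ r in (0:ℝ)..t, K (t - π.eta r) ^ 2 * u (π.eta r)
      ≤ κ ^ 2 * a * ((Real.exp (c * t) - 1) / c) := by
  have heta : ∀ r ∈ Ico 0 t, π.eta r ∈ Icc 0 T ∧ t - π.eta r ∈ Icc 0 T ∧
      u (π.eta r) ≤ a * Real.exp (c * r) := by
    intro r hr
    obtain ⟨k, hk, hkr, hle⟩ := π.exists_eta_eq hr.1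
    have h0 := π.t_nonneg hk
    have hT := π.t_le hk
    have hb := h k hk (by rw [hkr]; exact hle.trans_lt hr.2)
    rw [hkr] at h0 hT hb
    refine ⟨⟨h0, hT⟩, ⟨by linarith [hr.2], by linarith [ht.2]⟩, hb.trans ?_⟩
    gcongr
  have hexp : ∫ r in (0:ℝ)..t, κ ^ 2 * (a * Real.exp (c * r))
      = κ ^ 2 * a * ((Real.exp (c * t) - 1) / c) := by
    rw [intervalIntegral.integral_const_mul, intervalIntegral.integral_const_mul,
      intervalIntegral.integral_comp_mul_left (fun x => Real.exp x) hc.ne', integral_exp]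
    simp only [mul_zero, Real.exp_zero, smul_eq_mul]
    ring
  rw [← hexp, intervalIntegral.integral_of_le ht.1, intervalIntegral.integral_of_le ht.1,
    integral_Ioc_eq_integral_Ioo, integral_Ioc_eq_integral_Ioo]
  have hnonneg : ∀ r ∈ Ioo 0 t, 0 ≤ K (t - π.eta r) ^ 2 * u (π.eta r) := fun r hr =>
    mul_nonneg (sq_nonneg _) (hu _ (heta r ⟨hr.1.le, hr.2⟩).1)
  refine ⟨setIntegral_nonneg measurableSet_Ioo hnonneg, integral_mono_of_nonneg ?_ ?_ ?_⟩
  · exact (ae_restrict_iff' measurableSet_Ioo).mpr (Eventually.of_forall hnonneg)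
  · refine IntegrableOn.mono_set (t := Icc 0 t) ?_ Ioo_subset_Icc_self
    exact Continuous.integrableOn_Icc (by fun_prop)
  · refine (ae_restrict_iff' measurableSet_Ioo).mpr (Eventually.of_forall fun r hr => ?_)
    obtain ⟨he, hte, hb⟩ := heta r ⟨hr.1.le, hr.2⟩
    have := hK0 _ hte
    exact mul_le_mul (by have := hKκ _ hte; gcongr) hb (hu _ he) (sq_nonneg _)

/-- Discrete-time generalized Grönwall-type lemma (Lemma `lem:Gronwall_var`):
under the standing kernel assumption, a sequence of nonnegative bounded measurable
functions satisfying the Volterra-type inequality with the discretized kernel is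
uniformly bounded in `n` and `t`. -/
theorem gronwall_type_uniform_bound
    {T C H : ℝ} (hT : 0 < T) (hC : 0 < C) (hH : 0 < H)
    {K : ℝ → ℝ} (hK : StandingKernel T C H K)
    (π : ℕ → TimeGrid T)
    (q C₀ : ℝ) (hq : 2 ≤ q) (hC₀ : 0 < C₀)
    (f : ℕ → ℝ → ℝ)
    (hf_nonneg : ∀ n, ∀ t ∈ Icc (0:ℝ) T, 0 ≤ f n t)
    (hf_meas : ∀ n, Measurable (f n))
    (hf_bdd : ∀ n, BddAbove (f n '' Icc 0 T))
    (hf0 : ∃ M : ℝ, ∀ n, f n 0 ≤ M)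
    (hineq : ∀ n, ∀ s ∈ Icc (0:ℝ) T, ∀ t ∈ Icc (0:ℝ) T, s ≤ t →
      f n t ≤ C₀ * (1 + f n s)
        + C₀ * (∫ r in s..t,
            K (t - (π n).eta r) ^ 2 * (1 + f n ((π n).eta r) ^ (2 / q))) ^ (q / 2)
        + C₀ * (∫ r in (0:ℝ)..s,
            (K (t - (π n).eta r) - K (s - (π n).eta r)) ^ 2
              * (1 + f n ((π n).eta r) ^ (2 / q))) ^ (q / 2)) :
    ∃ B : ℝ, ∀ n, ∀ t ∈ Icc (0:ℝ) T, f n t ≤ B := by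
  obtain ⟨M, hM⟩ := hf0
  obtain ⟨hK0, hKanti, -⟩ := hK
  have h0T : (0:ℝ) ∈ Icc 0 T := ⟨le_rfl, hT.le⟩
  have hM0 : 0 ≤ M := (hf_nonneg 0 0 h0T).trans (hM 0)
  have hKκ : ∀ x ∈ Icc 0 T, K x ≤ K 0 := fun x hx => hKanti 0 h0T x hx hx.1
  have hq0 : 0 < q := by linarith
  set p := 2 / q with hp
  have hp0 : 0 < p := by positivity
  have hp1 : p ≤ 1 := (div_le_one hq0).mpr hq
  have hpq : q / 2 * p = 1 := by rw [hp]; field_simp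
  set a := 1 + (C₀ * (1 + M)) ^ p with ha
  have ha0 : 0 < a := by positivity
  set c := C₀ ^ p * K 0 ^ 2 + 1 with hc
  have hc0 : 0 < c := by positivity
  have key : ∀ n, ∀ t ∈ Icc (0:ℝ) T, 1 + f n t ^ p ≤ a * Real.exp (c * t) := by
    intro n
    refine (π n).induction_on_grid fun t ht h => ?_
    obtain ⟨hI0, hI⟩ := (π n).integral_sq_mul_le (u := fun x => 1 + f n x ^ p) hK0 hKκ
      (fun x hx => by have := hf_nonneg n x hx; positivity) ha0.le hc0 ht h
    have hft := hineq n 0 h0T t ht ht.1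
    rw [intervalIntegral.integral_same, Real.zero_rpow (by positivity), mul_zero, add_zero] at hft
    set I := ∫ r in (0:ℝ)..t, K (t - (π n).eta r) ^ 2 * (1 + f n ((π n).eta r) ^ p) with hIdef
    have hft' : f n t ≤ C₀ * (1 + M) + C₀ * I ^ (q / 2) :=
      hft.trans (by have := hM n; gcongr)
    have hIq : 0 ≤ I ^ (q / 2) := Real.rpow_nonneg hI0 _
    have hfp : f n t ^ p ≤ (C₀ * (1 + M)) ^ p + C₀ ^ p * I := by
      calc f n t ^ p ≤ (C₀ * (1 + M) + C₀ * I ^ (q / 2)) ^ p :=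
            Real.rpow_le_rpow (hf_nonneg n t ht) hft' hp0.le
        _ ≤ (C₀ * (1 + M)) ^ p + (C₀ * I ^ (q / 2)) ^ p :=
            Real.rpow_add_le_add_rpow (by positivity) (by positivity) hp0.le hp1
        _ = _ := by
            rw [Real.mul_rpow hC₀.le hIq, ← Real.rpow_mul hI0, hpq, Real.rpow_one]
    have hE : 0 ≤ (Real.exp (c * t) - 1) / c :=
      div_nonneg (sub_nonneg.mpr (Real.one_le_exp (mul_nonneg hc0.le ht.1))) hc0.le
    calc 1 + f n t ^ p ≤ a + C₀ ^ p * I := by linarith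
      _ ≤ a + C₀ ^ p * (K 0 ^ 2 * a * ((Real.exp (c * t) - 1) / c)) := by gcongr
      _ ≤ a + c * (a * ((Real.exp (c * t) - 1) / c)) := by
          have := mul_nonneg ha0.le hE
          rw [hc] at this ⊢
          linarith
      _ = a * Real.exp (c * t) := by field_simp; ring
  refine ⟨(a * Real.exp (c * T)) ^ (q / 2), fun n t ht => ?_⟩
  have hf := hf_nonneg n t ht
  calc f n t = (f n t ^ p) ^ (q / 2) := by
        rw [← Real.rpow_mul hf, mul_comm, hpq, Real.rpow_one]
    _ ≤ (a * Real.exp (c * T)) ^ (q / 2) := by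
        refine Real.rpow_le_rpow (by positivity) ?_ (by positivity)
        have h2 : a * Real.exp (c * t) ≤ a * Real.exp (c * T) := by
          have := ht.2
          gcongr
        linarith [key n t ht]
end

section
/- Let (π_n)_{n≥1} be a sequence of partitions of [0,T] with mesh |π_n| → 0, and suppose (x^n, z^n) → (x, z) in C([0,T],ℝ²) × C([0,T],ℝ²) for the uniform norm. Then for every f : ℝ² → ℝ that is twice continuously differentiable with f, ∇f and ∇²f bounded, one has lim_{n→∞} sup_{t ∈ [0,T]} | ∫_0^t 𝓛^n_s f(x^n, z^n) ds − ∫_0^t 𝓛_s f(x, z) ds | = 0, where 𝓛^n_s f(x, z) := b^n(s,x)·∇f(z(s)) + ½ Tr( a^n(s,x) ∇²f(z(s)) ) and 𝓛_s f(x, z) := b(x(s))·∇f(z(s)) + ½ Tr( a(x(s)) ∇²f(z(s)) ). -/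
open MeasureTheory Set Filter Matrix

/-- The drift coefficient `b(y,v) = (-v/2, θ - λ v₊)`. -/
noncomputable def bCoef (θ lam : ℝ) (x : ℝ × ℝ) : ℝ × ℝ :=
  (-x.2 / 2, θ - lam * max x.2 0)

/-- The diffusion coefficient `σ(y,v) = √(v₊) [[√(1-ρ²), ρ],[0, ν]]`. -/
noncomputable def σCoef (ρ ν : ℝ) (x : ℝ × ℝ) : Matrix (Fin 2) (Fin 2) ℝ :=
  Real.sqrt (max x.2 0) • !![Real.sqrt (1 - ρ ^ 2), ρ; 0, ν]

/-- `a = σ σᵀ`. -/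
noncomputable def aCoef (ρ ν : ℝ) (x : ℝ × ℝ) : Matrix (Fin 2) (Fin 2) ℝ :=
  σCoef ρ ν x * (σCoef ρ ν x)ᵀ

/-- The canonical basis of `ℝ²`. -/
def basis2 : Fin 2 → ℝ × ℝ := ![(1, 0), (0, 1)]

/-- The generator-type expression `b(x)·∇f(z) + ½ Tr( a(x) ∇²f(z) )`, written with
Fréchet derivatives: here `xv` is the value plugged into the coefficients and `zv` the
point at which the derivatives of `f` are evaluated. -/
noncomputable def genL (θ lam ρ ν : ℝ) (f : ℝ × ℝ → ℝ) (xv zv : ℝ × ℝ) : ℝ :=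
  fderiv ℝ f zv (bCoef θ lam xv)
    + (1 / 2) * ∑ i, ∑ j, aCoef ρ ν xv i j * fderiv ℝ (fderiv ℝ f) zv (basis2 i) (basis2 j)

namespace TimeGrid

variable {T : ℝ} (π : TimeGrid T)

lemma bddAbove_nodes_le (s : ℝ) : BddAbove {x | ∃ k ≤ π.n, π.t k = x ∧ x ≤ s} :=
  ⟨s, by rintro x ⟨k, -, -, h⟩; exact h⟩

lemma t_le_eta {k : ℕ} (hk : k ≤ π.n) {s : ℝ} (hs : π.t k ≤ s) : π.t k ≤ π.eta s :=
  le_csSup (π.bddAbove_nodes_le s) ⟨k, hk, rfl, hs⟩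

lemma eta_nonneg (s : ℝ) : 0 ≤ π.eta s := by
  by_cases hs : 0 ≤ s
  · simpa [π.first] using π.t_le_eta (Nat.zero_le _) (s := s) (by rwa [π.first])
  · refine Real.sSup_nonneg ?_
    have h0 : ∀ k ≤ π.n, 0 ≤ π.t k := by
      intro k
      induction k with
      | zero => intro _; exact π.first.ge
      | succ k ih => intro hk; exact (ih (by omega)).trans (π.strict k (by omega)).le
    rintro x ⟨k, hk, rfl, -⟩
    exact h0 k hk

lemma eta_le {s : ℝ} (hs : 0 ≤ s) : π.eta s ≤ s :=
  Real.sSup_le (by rintro x ⟨k, -, -, h⟩; exact h) hs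

lemma monotone_eta : Monotone π.eta := fun s s' h =>
  Real.sSup_le (by rintro x ⟨k, hk, rfl, hx⟩; exact π.t_le_eta hk (hx.trans h)) (π.eta_nonneg s')

lemma step_le_mesh {k : ℕ} (hk : k < π.n) : π.t (k + 1) - π.t k ≤ π.mesh := by
  refine le_csSup (Set.Finite.bddAbove ?_) ⟨k, hk, rfl⟩
  refine ((Set.finite_Iio π.n).image fun k => π.t (k + 1) - π.t k).subset ?_
  rintro d ⟨k, hk, rfl⟩
  exact ⟨k, hk, rfl⟩

lemma sub_eta_le_mesh {s : ℝ} (hs : s ∈ Set.Icc 0 T) : s - π.eta s ≤ π.mesh := by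
  classical
  set k := Nat.findGreatest (fun k => π.t k ≤ s) π.n with hk
  have hkn : k ≤ π.n := Nat.findGreatest_le _
  have hks : π.t k ≤ s :=
    Nat.findGreatest_spec (P := fun k => π.t k ≤ s) (Nat.zero_le _) (by rw [π.first]; exact hs.1)
  have hη := π.t_le_eta hkn hks
  rcases hkn.lt_or_eq with hlt | heq
  · have hnext : ¬ π.t (k + 1) ≤ s :=
      Nat.findGreatest_is_greatest (P := fun k => π.t k ≤ s) (Nat.lt_succ_self k) hlt
    have := π.step_le_mesh hlt
    linarith
  · rw [heq, π.last] at hη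
    have := π.step_le_mesh π.npos
    have := π.strict 0 π.npos
    linarith [hs.2]

lemma dist_eta_le_mesh {s : ℝ} (hs : s ∈ Set.Icc 0 T) : dist (π.eta s) s ≤ π.mesh := by
  rw [dist_comm, Real.dist_eq, abs_of_nonneg (sub_nonneg.2 (π.eta_le hs.1))]
  exact π.sub_eta_le_mesh hs

end TimeGrid

lemma continuous_bCoef (θ lam : ℝ) : Continuous (bCoef θ lam) := by
  unfold bCoef
  fun_prop

lemma continuous_aCoef (ρ ν : ℝ) : Continuous (aCoef ρ ν) := by
  have hσ : Continuous (σCoef ρ ν) := by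
    unfold σCoef
    fun_prop
  exact hσ.matrix_mul hσ.matrix_transpose

lemma continuous_genL (θ lam ρ ν : ℝ) {f : ℝ × ℝ → ℝ} (hf : ContDiff ℝ 2 f) :
    Continuous fun p : (ℝ × ℝ) × (ℝ × ℝ) => genL θ lam ρ ν f p.1 p.2 := by
  have h1 : Continuous (fderiv ℝ f) := hf.continuous_fderiv (by norm_num)
  have h2 : Continuous (fderiv ℝ (fderiv ℝ f)) :=
    (hf.fderiv_right (m := 1) (by norm_num)).continuous_fderiv (by norm_num)
  have hb := continuous_bCoef θ lam
  have ha := continuous_aCoef ρ ν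
  unfold genL
  refine ((h1.comp continuous_snd).clm_apply (hb.comp continuous_fst)).add
    (continuous_const.mul (continuous_finsetSum _ fun i _ => continuous_finsetSum _ fun j _ => ?_))
  exact ((ha.comp continuous_fst).matrix_elem i j).mul
    (((h2.comp continuous_snd).clm_apply continuous_const).clm_apply continuous_const)

/-- Uniform convergence of the time-discretised integrands for a general continuous integrand. -/
lemma eventually_dist_comp_eta_lt {E F G : Type*} [PseudoMetricSpace E] [PseudoMetricSpace F]
    [PseudoMetricSpace G] {T : ℝ} (hT : 0 < T) {g : E × F → G} (hg : Continuous g)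
    (π : ℕ → TimeGrid T) (hmesh : Tendsto (fun n => (π n).mesh) atTop (nhds 0))
    {xn : ℕ → C(Set.Icc (0:ℝ) T, E)} {zn : ℕ → C(Set.Icc (0:ℝ) T, F)}
    {x : C(Set.Icc (0:ℝ) T, E)} {z : C(Set.Icc (0:ℝ) T, F)}
    (hxn : Tendsto xn atTop (nhds x)) (hzn : Tendsto zn atTop (nhds z))
    {ε : ℝ} (hε : 0 < ε) :
    ∀ᶠ n in atTop, ∀ s ∈ Set.Icc 0 T,
      dist (g (xn n (Set.projIcc 0 T hT.le ((π n).eta s)), zn n (Set.projIcc 0 T hT.le s)))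
        (g (x (Set.projIcc 0 T hT.le s), z (Set.projIcc 0 T hT.le s))) < ε := by
  have hK : IsCompact (Set.range fun s => (x s, z s)) :=
    isCompact_range (x.continuous.prodMk z.continuous)
  obtain ⟨δ, hδ, hgδ⟩ := Metric.mem_uniformity_dist.1
    (hK.uniformContinuousAt_of_continuousAt g (fun p _ => hg.continuousAt)
      (Metric.dist_mem_uniformity hε))
  obtain ⟨r, hr, hxr⟩ := Metric.uniformContinuous_iff.1
    (CompactSpace.uniformContinuous_of_continuous x.continuous) (δ / 2) (half_pos hδ)
  filter_upwards [hmesh.eventually_lt_const hr, Metric.tendsto_nhds.1 hxn _ (half_pos hδ),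
    Metric.tendsto_nhds.1 hzn _ hδ] with n hn hx hz s hs
  rw [dist_comm]
  refine hgδ ?_ ⟨_, rfl⟩
  rw [dist_comm, Prod.dist_eq, max_lt_iff]
  refine ⟨?_, (ContinuousMap.dist_apply_le_dist _).trans_lt hz⟩
  have hproj : dist (Set.projIcc 0 T hT.le ((π n).eta s)) (Set.projIcc 0 T hT.le s) < r := by
    have hη : (π n).eta s ∈ Set.Icc 0 T :=
      ⟨(π n).eta_nonneg s, ((π n).eta_le hs.1).trans hs.2⟩
    rw [Set.projIcc_of_mem _ hη, Set.projIcc_of_mem _ hs, Subtype.dist_eq]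
    exact ((π n).dist_eta_le_mesh hs).trans_lt hn
  calc _ ≤ _ := dist_triangle _ (x (Set.projIcc 0 T hT.le ((π n).eta s))) _
    _ < δ / 2 + δ / 2 :=
      add_lt_add ((ContinuousMap.dist_apply_le_dist _).trans_lt hx) (hxr hproj)
    _ = δ := add_halves δ

/-- The time-discretised integrand is interval integrable. -/
lemma intervalIntegrable_comp_eta {T : ℝ} (hT : 0 < T) {g : (ℝ × ℝ) × (ℝ × ℝ) → ℝ}
    (hg : Continuous g) (π : TimeGrid T) (x z : C(Set.Icc (0:ℝ) T, ℝ × ℝ)) (a b : ℝ) :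
    IntervalIntegrable
      (fun s => g (x (Set.projIcc 0 T hT.le (π.eta s)), z (Set.projIcc 0 T hT.le s)))
      volume a b := by
  have hK : IsCompact (Set.range x ×ˢ Set.range z) :=
    (isCompact_range x.continuous).prod (isCompact_range z.continuous)
  obtain ⟨C, hC⟩ := hK.exists_bound_of_continuousOn hg.continuousOn
  have hmeas : Measurable
      fun s => g (x (Set.projIcc 0 T hT.le (π.eta s)), z (Set.projIcc 0 T hT.le s)) :=
    hg.measurable.comp <|
      ((x.continuous.comp continuous_projIcc).measurable.comp π.monotone_eta.measurable).prodMk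
        (z.continuous.comp continuous_projIcc).measurable
  exact (intervalIntegrable_const (c := C)).mono_fun' hmeas.aestronglyMeasurable
    (ae_of_all _ fun s => hC _ ⟨⟨_, rfl⟩, ⟨_, rfl⟩⟩)

/-- Lemma `conv`: if `(xⁿ, zⁿ) → (x, z)` uniformly on `[0,T]` and the mesh of the partitions
tends to `0`, then for every `C²` function `f` with bounded `f`, `∇f`, `∇²f`, the integrated
discretized generators converge to the integrated generator, uniformly in `t ∈ [0,T]`. -/
theorem generator_uniform_convergence
    {T : ℝ} (hT : 0 < T) (θ lam ν ρ : ℝ)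
    (hθ : 0 < θ) (hlam : 0 < lam) (hν : 0 < ν) (hρ : ρ ∈ Set.Ioo (-1 : ℝ) 1)
    (π : ℕ → TimeGrid T)
    (hmesh : Filter.Tendsto (fun n => (π n).mesh) Filter.atTop (nhds 0))
    (xn zn : ℕ → C(Set.Icc (0:ℝ) T, ℝ × ℝ)) (x z : C(Set.Icc (0:ℝ) T, ℝ × ℝ))
    (hxn : Filter.Tendsto xn Filter.atTop (nhds x))
    (hzn : Filter.Tendsto zn Filter.atTop (nhds z))
    (f : ℝ × ℝ → ℝ) (hf : ContDiff ℝ 2 f)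
    (hfbdd : ∃ Cf : ℝ, ∀ w : ℝ × ℝ,
      |f w| ≤ Cf ∧ ‖fderiv ℝ f w‖ ≤ Cf ∧ ‖fderiv ℝ (fderiv ℝ f) w‖ ≤ Cf) :
    ∀ ε > 0, ∃ N : ℕ, ∀ n ≥ N, ∀ t ∈ Set.Icc (0:ℝ) T,
      |(∫ s in (0:ℝ)..t, genL θ lam ρ ν f
            (xn n (Set.projIcc 0 T hT.le ((π n).eta s)))
            (zn n (Set.projIcc 0 T hT.le s)))
        - ∫ s in (0:ℝ)..t, genL θ lam ρ ν f
            (x (Set.projIcc 0 T hT.le s)) (z (Set.projIcc 0 T hT.le s))| < ε := by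
  intro ε hε
  have hg := continuous_genL θ lam ρ ν hf
  obtain ⟨N, hN⟩ := eventually_atTop.1
    (eventually_dist_comp_eta_lt hT hg π hmesh hxn hzn (div_pos hε (mul_pos two_pos hT)))
  refine ⟨N, fun n hn t ht => ?_⟩
  have hlim : Continuous fun s =>
      genL θ lam ρ ν f (x (Set.projIcc 0 T hT.le s)) (z (Set.projIcc 0 T hT.le s)) :=
    hg.comp ((x.continuous.comp continuous_projIcc).prodMk (z.continuous.comp continuous_projIcc))
  rw [← intervalIntegral.integral_sub (intervalIntegrable_comp_eta hT hg (π n) (xn n) (zn n) 0 t)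
    (hlim.intervalIntegrable 0 t), ← Real.norm_eq_abs]
  refine (intervalIntegral.norm_integral_le_of_norm_le_const (C := ε / (2 * T))
    fun s hs => ?_).trans_lt ?_
  · rw [Set.uIoc_of_le ht.1] at hs
    exact (hN n hn s ⟨hs.1.le, hs.2.trans ht.2⟩).le
  rw [sub_zero, abs_of_nonneg ht.1]
  calc ε / (2 * T) * t ≤ ε / (2 * T) * T := by gcongr; exact ht.2
    _ = ε / 2 := by field_simp
    _ < ε := half_lt_self hε
end

section
/- Let H ∈ (0, 1/2) and define K(u) := u^{H−1/2} for u > 0. Then there exists a constant C > 0 depending only on H such that for every T > 0, every measurable function η : [0,T] → [0,T] with η(s) ≤ s for all s, every t ∈ (0,T) and every δ ∈ (0, T − t], one has ∫_0^t | K(t + δ − η(s)) − K(t − η(s)) |² ds ≤ C δ^{2H}. -/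
open MeasureTheory Set

/-- Majorant of the squared increment over a lag `δ` of the power kernel with exponent `a`. -/
noncomputable def powIncrementMajorant (a δ u : ℝ) : ℝ :=
  if u ≤ δ then u ^ (2 * a) else δ ^ 2 * u ^ (2 * a - 2)

lemma rpow_sub_rpow_add_le {a δ v : ℝ} (ha : -1 ≤ a) (hδ : 0 < δ) (hv : 0 < v) :
    v ^ a - (v + δ) ^ a ≤ δ * v ^ (a - 1) := by
  have hvδ : 0 < v + δ := by positivity
  have hmono : v ^ (a + 1) ≤ (v + δ) ^ (a + 1) :=
    Real.rpow_le_rpow hv.le (by linarith) (by linarith)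
  rw [Real.rpow_add_one hv.ne', Real.rpow_add_one hvδ.ne'] at hmono
  have hva : 0 < v ^ a := Real.rpow_pos_of_pos hv a
  have hanti : (v ^ a - (v + δ) ^ a) * (v + δ) ≤ δ * v ^ a := by linarith
  rw [Real.rpow_sub_one hv.ne', ← mul_div_assoc, le_div_iff₀ hv]
  rcases le_total (v ^ a) ((v + δ) ^ a) with h | h <;> nlinarith [mul_pos hδ hva]

lemma sq_rpow_increment_le_majorant {a δ u v : ℝ} (ha : -1 ≤ a) (ha0 : a ≤ 0) (hδ : 0 < δ)
    (hu : 0 < u) (huv : u ≤ v) :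
    ((v + δ) ^ a - v ^ a) ^ 2 ≤ powIncrementMajorant a δ u := by
  have hv : 0 < v := hu.trans_le huv
  have h0 : 0 ≤ v ^ a - (v + δ) ^ a :=
    sub_nonneg.2 (Real.rpow_le_rpow_of_nonpos hv (by linarith) ha0)
  have hsq : ∀ b : ℝ, (u ^ b) ^ 2 = u ^ (2 * b) := fun b ↦ by
    rw [← Real.rpow_mul_natCast hu.le, mul_comm]; norm_num
  rw [← neg_sq, neg_sub, powIncrementMajorant]
  split_ifs
  · rw [← hsq]
    refine pow_le_pow_left₀ h0 ?_ 2
    have h1 : v ^ a ≤ u ^ a := Real.rpow_le_rpow_of_nonpos hu huv ha0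
    have h2 : 0 ≤ (v + δ) ^ a := by positivity
    linarith
  · rw [show 2 * a - 2 = 2 * (a - 1) by ring, ← hsq, ← mul_pow]
    refine pow_le_pow_left₀ h0 ((rpow_sub_rpow_add_le ha hδ hv).trans ?_) 2
    exact mul_le_mul_of_nonneg_left
      (Real.rpow_le_rpow_of_nonpos hu huv (by linarith)) hδ.le

lemma powIncrementMajorant_nonneg {a δ u : ℝ} (hu : 0 ≤ u) :
    0 ≤ powIncrementMajorant a δ u := by
  unfold powIncrementMajorant
  split_ifs <;> positivity

lemma powIncrementMajorant_eqOn_Ioc (a δ : ℝ) :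
    EqOn (powIncrementMajorant a δ) (fun u ↦ u ^ (2 * a)) (Ioc 0 δ) :=
  fun _ hu ↦ if_pos hu.2

lemma powIncrementMajorant_eqOn_Ioi (a δ : ℝ) :
    EqOn (powIncrementMajorant a δ) (fun u ↦ δ ^ 2 * u ^ (2 * a - 2)) (Ioi δ) :=
  fun _ hu ↦ if_neg (not_le.2 hu)

lemma integrableOn_powIncrementMajorant_Ioc {a δ : ℝ} (ha : -1 / 2 < a) (hδ : 0 < δ) :
    IntegrableOn (powIncrementMajorant a δ) (Ioc 0 δ) := by
  rw [integrableOn_congr_fun (powIncrementMajorant_eqOn_Ioc a δ) measurableSet_Ioc,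
    ← intervalIntegrable_iff_integrableOn_Ioc_of_le hδ.le]
  exact intervalIntegral.intervalIntegrable_rpow' (by linarith)

lemma integrableOn_powIncrementMajorant_Ioi {a δ : ℝ} (ha : a < 1 / 2) (hδ : 0 < δ) :
    IntegrableOn (powIncrementMajorant a δ) (Ioi δ) := by
  rw [integrableOn_congr_fun (powIncrementMajorant_eqOn_Ioi a δ) measurableSet_Ioi]
  exact (integrableOn_Ioi_rpow_of_lt (by linarith) hδ).const_mul _

lemma integrableOn_powIncrementMajorant {a δ : ℝ} (ha : -1 / 2 < a) (ha' : a < 1 / 2)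
    (hδ : 0 < δ) : IntegrableOn (powIncrementMajorant a δ) (Ioi 0) := by
  rw [← Ioc_union_Ioi_eq_Ioi hδ.le]
  exact (integrableOn_powIncrementMajorant_Ioc ha hδ).union
    (integrableOn_powIncrementMajorant_Ioi ha' hδ)

lemma integral_powIncrementMajorant {a δ : ℝ} (ha : -1 / 2 < a) (ha' : a < 1 / 2)
    (hδ : 0 < δ) :
    ∫ u in Ioi 0, powIncrementMajorant a δ u =
      (1 / (2 * a + 1) + 1 / (1 - 2 * a)) * δ ^ (2 * a + 1) := by
  rw [← Ioc_union_Ioi_eq_Ioi hδ.le,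
    setIntegral_union (Ioc_disjoint_Ioi le_rfl) measurableSet_Ioi
      (integrableOn_powIncrementMajorant_Ioc ha hδ)
      (integrableOn_powIncrementMajorant_Ioi ha' hδ),
    setIntegral_congr_fun measurableSet_Ioc (powIncrementMajorant_eqOn_Ioc a δ),
    setIntegral_congr_fun measurableSet_Ioi (powIncrementMajorant_eqOn_Ioi a δ),
    integral_const_mul, integral_Ioi_rpow_of_lt (by linarith) hδ,
    ← intervalIntegral.integral_of_le hδ.le, integral_rpow (Or.inl (by linarith)),
    Real.zero_rpow (by linarith), show 2 * a + 1 = 2 * a - 2 + 1 + (2 : ℕ) by norm_num; ring,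
    Real.rpow_add_natCast hδ.ne', show 2 * a - 2 + 1 = -(1 - 2 * a) by ring]
  rw [neg_div_neg_eq]
  ring

/-- Condition (A3) for the fractional kernel `K(u) = u^{H-1/2}`, `H ∈ (0,1/2)`:
there is a constant `C > 0` depending only on `H` such that for every horizon `T > 0`,
every measurable `η : [0,T] → [0,T]` with `η(s) ≤ s`, every `t ∈ (0,T)` and
`δ ∈ (0, T-t]`, one has `∫_0^t |K(t+δ-η(s)) - K(t-η(s))|² ds ≤ C δ^{2H}`. -/
theorem fractional_kernel_A3 (H : ℝ) (hH : H ∈ Set.Ioo (0:ℝ) (1/2)) :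
    ∃ C > (0:ℝ), ∀ T > (0:ℝ), ∀ η : ℝ → ℝ, Measurable η →
      (∀ s ∈ Set.Icc (0:ℝ) T, η s ∈ Set.Icc (0:ℝ) T ∧ η s ≤ s) →
      ∀ t ∈ Set.Ioo (0:ℝ) T, ∀ δ ∈ Set.Ioc (0:ℝ) (T - t),
        (∫ s in (0:ℝ)..t,
            ((t + δ - η s) ^ (H - 1/2) - (t - η s) ^ (H - 1/2)) ^ 2) ≤ C * δ ^ (2 * H) := by
  obtain ⟨hH0, hH1⟩ := hH
  have hC1 : 0 < 1 / (2 * (H - 1 / 2) + 1) := one_div_pos.2 (by linarith)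
  have hC2 : 0 < 1 / (1 - 2 * (H - 1 / 2)) := one_div_pos.2 (by linarith)
  refine ⟨_, add_pos hC1 hC2, fun T _ η _ hη t ht δ hδ ↦ ?_⟩
  have ha : -1 / 2 < H - 1 / 2 := by linarith
  have ha' : H - 1 / 2 < 1 / 2 := by linarith
  have hg := integrableOn_powIncrementMajorant ha ha' hδ.1
  have hgt : IntervalIntegrable (powIncrementMajorant (H - 1 / 2) δ) volume 0 t :=
    (intervalIntegrable_iff_integrableOn_Ioc_of_le ht.1.le).2 (hg.mono_set Ioc_subset_Ioi_self)
  have hgs : IntervalIntegrable (fun s ↦ powIncrementMajorant (H - 1 / 2) δ (t - s)) volume 0 t := by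
    simpa using (hgt.comp_sub_left t).symm
  calc
    _ ≤ ∫ s in (0:ℝ)..t, powIncrementMajorant (H - 1 / 2) δ (t - s) := by
      rw [intervalIntegral.integral_of_le ht.1.le, intervalIntegral.integral_of_le ht.1.le,
        integral_Ioc_eq_integral_Ioo, integral_Ioc_eq_integral_Ioo]
      refine integral_mono_of_nonneg (Filter.Eventually.of_forall fun _ ↦ sq_nonneg _)
        (((intervalIntegrable_iff_integrableOn_Ioc_of_le ht.1.le).1 hgs).mono_set
          Ioo_subset_Ioc_self) ?_
      filter_upwards [ae_restrict_mem measurableSet_Ioo] with s hs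
      have hηs := (hη s ⟨hs.1.le, hs.2.le.trans ht.2.le⟩).2
      rw [show t + δ - η s = t - η s + δ by ring]
      exact sq_rpow_increment_le_majorant (by linarith) (by linarith) hδ.1
        (sub_pos.2 hs.2) (by linarith)
    _ = ∫ u in Ioc 0 t, powIncrementMajorant (H - 1 / 2) δ u := by
      rw [intervalIntegral.integral_comp_sub_left (powIncrementMajorant (H - 1 / 2) δ), sub_self,
        sub_zero, intervalIntegral.integral_of_le ht.1.le]
    _ ≤ ∫ u in Ioi 0, powIncrementMajorant (H - 1 / 2) δ u := by
      refine setIntegral_mono_set hg ?_ Ioc_subset_Ioi_self.eventuallyLE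
      filter_upwards [ae_restrict_mem measurableSet_Ioi] with u hu
      exact powIncrementMajorant_nonneg (le_of_lt hu)
    _ = _ := by
      rw [integral_powIncrementMajorant ha ha' hδ.1]
      congr 2
      ring
end

section
/- Let C > 0, β > 0 and H ∈ (0, 1/2), and define K(u) := C e^{−βu} u^{H−1/2} for u > 0. Then there exists a constant C' > 0, depending only on C, β and H, such that for every T > 0, every measurable function η : [0,T] → [0,T] with η(s) ≤ s for all s, every t ∈ [0,T) and every δ ∈ (0, T − t], both of the following hold: ∫_t^{t+δ} K(t + δ − η(s))² ds ≤ C' δ^{2H} and ∫_0^t | K(t + δ − η(s)) − K(t − η(s)) |² ds ≤ C' δ^{2H}. -/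
open MeasureTheory Set

/-- `K(u) ≤ C v^a` for `0 < v ≤ u`, where `K(u) = C e^{-βu} u^a` and `a ≤ 0`. -/
lemma damped_rpow_le {C β a u v : ℝ} (hC : 0 < C) (hβ : 0 < β) (ha : a ≤ 0)
    (hv : 0 < v) (huv : v ≤ u) :
    C * Real.exp (-β * u) * u ^ a ≤ C * v ^ a := by
  have hu : 0 < u := hv.trans_le huv
  have h1 : Real.exp (-β * u) ≤ 1 := Real.exp_le_one_iff.2 (by nlinarith)
  have h2 : u ^ a ≤ v ^ a := Real.rpow_le_rpow_of_nonpos hv huv ha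
  have h3 : 0 < u ^ a := Real.rpow_pos_of_pos hu a
  calc C * Real.exp (-β * u) * u ^ a ≤ C * 1 * v ^ a := by gcongr
    _ = C * v ^ a := by ring

/-- The kernel `K(u) = C e^{-βu} u^a` is nonincreasing on `(0, ∞)` when `a ≤ 0`. -/
lemma damped_rpow_antitone {C β a u δ : ℝ} (hC : 0 < C) (hβ : 0 < β) (ha : a ≤ 0)
    (hu : 0 < u) (hδ : 0 < δ) :
    C * Real.exp (-β * (u + δ)) * (u + δ) ^ a ≤ C * Real.exp (-β * u) * u ^ a := by
  have h1 : Real.exp (-β * (u + δ)) ≤ Real.exp (-β * u) := Real.exp_le_exp.2 (by nlinarith)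
  have h2 : (u + δ) ^ a ≤ u ^ a := Real.rpow_le_rpow_of_nonpos hu (by linarith) ha
  have h3 : 0 < (u + δ) ^ a := Real.rpow_pos_of_pos (by linarith) a
  gcongr

/-- Increments of `K(u) = C e^{-βu} u^a` over a step `δ` are at most `2 C δ u^{a-1}`. -/
lemma damped_rpow_sub_le {C β a u δ : ℝ} (hC : 0 < C) (hβ : 0 < β) (ha : a ≤ 0)
    (ha' : -1 ≤ a) (hu : 0 < u) (hδ : 0 < δ) :
    C * Real.exp (-β * u) * u ^ a - C * Real.exp (-β * (u + δ)) * (u + δ) ^ a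
      ≤ C * (2 * δ * u ^ (a - 1)) := by
  have hx : 0 < δ / u := by positivity
  have hq : 1 - δ / u ≤ (1 + δ / u) ^ a := by
    calc 1 - δ / u ≤ (1 + δ / u)⁻¹ := by
          rw [← one_div, le_div_iff₀ (by linarith)]; nlinarith
      _ = (1 + δ / u) ^ (-1 : ℝ) := by rw [Real.rpow_neg_one]
      _ ≤ (1 + δ / u) ^ a := Real.rpow_le_rpow_of_exponent_le (by linarith) ha'
  have hq1 : (1 + δ / u) ^ a ≤ 1 := Real.rpow_le_one_of_one_le_of_nonpos (by linarith) ha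
  have hp : 1 - β * δ ≤ Real.exp (-β * δ) := by
    linarith [Real.add_one_le_exp (-β * δ)]
  have hp1 : Real.exp (-β * δ) ≤ 1 := Real.exp_le_one_iff.2 (by nlinarith)
  have he : Real.exp (-β * (u + δ)) = Real.exp (-β * u) * Real.exp (-β * δ) := by
    rw [← Real.exp_add]; ring_nf
  have hr : (u + δ) ^ a = u ^ a * (1 + δ / u) ^ a := by
    rw [← Real.mul_rpow hu.le (by linarith)]; congr 1; field_simp
  have hE1 : Real.exp (-β * u) ≤ 1 := Real.exp_le_one_iff.2 (by nlinarith)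
  have hE2 : Real.exp (-β * u) * (β * u) ≤ 1 := by
    have h := Real.add_one_le_exp (β * u)
    calc Real.exp (-β * u) * (β * u) ≤ Real.exp (-β * u) * Real.exp (β * u) := by
          gcongr; linarith
      _ = 1 := by rw [← Real.exp_add]; simp
  have hua : u ^ a = u ^ (a - 1) * u := by
    rw [Real.rpow_sub_one hu.ne']; field_simp
  have hw : 0 < u ^ (a - 1) := Real.rpow_pos_of_pos hu _
  rw [he, hr, hua]
  generalize Real.exp (-β * δ) = p at *
  generalize (1 + δ / u) ^ a = q at *
  generalize hEE : Real.exp (-β * u) = E at *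
  have hE0 : 0 < E := hEE ▸ Real.exp_pos _
  have hpq : 1 - p * q ≤ β * δ + δ / u := by nlinarith
  have key : E * u * (1 - p * q) ≤ 2 * δ := by
    calc E * u * (1 - p * q) ≤ E * u * (β * δ + δ / u) := by gcongr
      _ = E * (β * u) * δ + E * δ := by field_simp
      _ ≤ 1 * δ + 1 * δ := by gcongr
      _ = 2 * δ := by ring
  calc C * E * (u ^ (a - 1) * u) - C * (E * p) * (u ^ (a - 1) * u * q)
      = C * u ^ (a - 1) * (E * u * (1 - p * q)) := by ring
    _ ≤ C * u ^ (a - 1) * (2 * δ) := by gcongr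
    _ = C * (2 * δ * u ^ (a - 1)) := by ring

lemma rpow_sq_eq {x : ℝ} (hx : 0 < x) (a : ℝ) : (x ^ a) ^ 2 = x ^ (2 * a) := by
  rw [← Real.rpow_natCast, ← Real.rpow_mul hx.le]; congr 1; push_cast; ring

/-- An integrable majorant for squared kernel increments: `v^{2a}` near the singularity
and `4 δ² v^{2a-2}` away from it. -/
noncomputable def incrementMajorant (C a δ : ℝ) (v : ℝ) : ℝ :=
  (Ioc 0 δ).indicator (fun v => C ^ 2 * v ^ (2 * a)) v +
    (Ioi δ).indicator (fun v => C ^ 2 * (4 * δ ^ 2) * v ^ (2 * a - 2)) v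

lemma incrementMajorant_nonneg {C a δ : ℝ} (hδ : 0 < δ) (v : ℝ) :
    0 ≤ incrementMajorant C a δ v := by
  refine add_nonneg (indicator_nonneg (fun v hv => ?_) v) (indicator_nonneg (fun v hv => ?_) v)
  · have := Real.rpow_nonneg hv.1.le (2 * a)
    positivity
  · have := Real.rpow_nonneg (hδ.trans hv).le (2 * a - 2)
    positivity

lemma integrableOn_Ioc_const_mul_rpow {c b δ : ℝ} (hδ : 0 < δ) (hb : -1 < b) :
    IntegrableOn (fun v : ℝ => c * v ^ b) (Ioc 0 δ) := by
  rw [← intervalIntegrable_iff_integrableOn_Ioc_of_le hδ.le]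
  exact (intervalIntegral.intervalIntegrable_rpow' hb).const_mul c

lemma integrableOn_Ioi_const_mul_rpow {c b δ : ℝ} (hδ : 0 < δ) (hb : b < -1) :
    IntegrableOn (fun v : ℝ => c * v ^ b) (Ioi δ) :=
  (integrableOn_Ioi_rpow_of_lt hb hδ).const_mul c

lemma integrable_incrementMajorant {C a δ : ℝ} (hδ : 0 < δ) (ha : a ≤ 0) (ha' : -1 < 2 * a) :
    Integrable (incrementMajorant C a δ) :=
  ((integrable_indicator_iff measurableSet_Ioc).2
    (integrableOn_Ioc_const_mul_rpow hδ ha')).add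
  ((integrable_indicator_iff measurableSet_Ioi).2
    (integrableOn_Ioi_const_mul_rpow hδ (by linarith)))

lemma integral_const_mul_rpow {c b δ : ℝ} (hb : -1 < b) :
    ∫ v in (0:ℝ)..δ, c * v ^ b = c * (δ ^ (b + 1) / (b + 1)) := by
  rw [intervalIntegral.integral_const_mul, integral_rpow (Or.inl hb),
    Real.zero_rpow (by linarith), sub_zero]

lemma integral_incrementMajorant {C a δ : ℝ} (hδ : 0 < δ) (ha : a ≤ 0) (ha' : -1 < 2 * a) :
    ∫ v, incrementMajorant C a δ v
      = C ^ 2 * (1 / (2 * a + 1) + 4 / (1 - 2 * a)) * δ ^ (2 * a + 1) := by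
  have h1 : ∫ v in Ioc 0 δ, C ^ 2 * v ^ (2 * a) = C ^ 2 * (δ ^ (2 * a + 1) / (2 * a + 1)) := by
    rw [← intervalIntegral.integral_of_le hδ.le, integral_const_mul_rpow ha']
  have h2 : ∫ v in Ioi δ, C ^ 2 * (4 * δ ^ 2) * v ^ (2 * a - 2)
      = C ^ 2 * (4 / (1 - 2 * a)) * δ ^ (2 * a + 1) := by
    have hpow : δ ^ (2 * a + 1) = δ ^ 2 * δ ^ (2 * a - 2 + 1) := by
      rw [← Real.rpow_natCast, ← Real.rpow_add hδ]; congr 1; push_cast; ring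
    rw [integral_const_mul, integral_Ioi_rpow_of_lt (by linarith) hδ, hpow]
    rw [show 2 * a - 2 + 1 = -(1 - 2 * a) by ring, neg_div_neg_eq]
    ring
  unfold incrementMajorant
  rw [integral_add
    ((integrable_indicator_iff measurableSet_Ioc).2 (integrableOn_Ioc_const_mul_rpow hδ ha'))
    ((integrable_indicator_iff measurableSet_Ioi).2
      (integrableOn_Ioi_const_mul_rpow hδ (by linarith))),
    integral_indicator measurableSet_Ioc, integral_indicator measurableSet_Ioi, h1, h2]
  ring

lemma sq_damped_rpow_sub_le_incrementMajorant {C β a u v δ : ℝ} (hC : 0 < C) (hβ : 0 < β)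
    (ha : a ≤ 0) (ha' : -1 ≤ a) (hv : 0 < v) (huv : v ≤ u) (hδ : 0 < δ) :
    (C * Real.exp (-β * (u + δ)) * (u + δ) ^ a - C * Real.exp (-β * u) * u ^ a) ^ 2
      ≤ incrementMajorant C a δ v := by
  have hu : 0 < u := hv.trans_le huv
  have hmono := damped_rpow_antitone hC hβ ha hu hδ
  rw [← neg_sq, neg_sub]
  unfold incrementMajorant
  rcases le_or_gt v δ with hvδ | hvδ
  · rw [indicator_of_mem (show v ∈ Ioc 0 δ from ⟨hv, hvδ⟩),
      indicator_of_notMem (by simpa using hvδ), add_zero, ← rpow_sq_eq hv, ← mul_pow]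
    have h0 : 0 < (u + δ) ^ a := Real.rpow_pos_of_pos (by linarith) a
    have h1 : 0 < C * Real.exp (-β * (u + δ)) * (u + δ) ^ a := by positivity
    have h2 := damped_rpow_le hC hβ ha hv huv
    exact pow_le_pow_left₀ (by linarith) (by linarith) 2
  · rw [indicator_of_notMem (fun h => hvδ.not_ge h.2),
      indicator_of_mem (show v ∈ Ioi δ from hvδ), zero_add]
    have h1 : u ^ (a - 1) ≤ v ^ (a - 1) := Real.rpow_le_rpow_of_nonpos hv huv (by linarith)
    have h2 := damped_rpow_sub_le hC hβ ha ha' hu hδ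
    have h3 : C * (2 * δ * u ^ (a - 1)) ≤ C * (2 * δ * v ^ (a - 1)) := by gcongr
    calc _ ≤ (C * (2 * δ * v ^ (a - 1))) ^ 2 :=
          pow_le_pow_left₀ (by linarith) (by linarith) 2
      _ = C ^ 2 * (4 * δ ^ 2) * (v ^ (a - 1)) ^ 2 := by ring
      _ = _ := by rw [rpow_sq_eq hv]; ring_nf

/-- Interval integrals of nonnegative functions are monotone without measurability of the
smaller function. -/
lemma intervalIntegral_le_of_nonneg_of_le {f g : ℝ → ℝ} {x y : ℝ} (hxy : x ≤ y)
    (hg : IntervalIntegrable g volume x y) (hf : ∀ s, 0 ≤ f s)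
    (hfg : ∀ s ∈ Ioo x y, f s ≤ g s) :
    ∫ s in x..y, f s ≤ ∫ s in x..y, g s := by
  rw [intervalIntegral.integral_of_le hxy, intervalIntegral.integral_of_le hxy,
    integral_Ioc_eq_integral_Ioo, integral_Ioc_eq_integral_Ioo]
  refine integral_mono_of_nonneg (.of_forall hf) ?_
    ((ae_restrict_iff' measurableSet_Ioo).2 (.of_forall hfg))
  exact ((intervalIntegrable_iff_integrableOn_Ioc_of_le hxy).1 hg).mono_set Ioo_subset_Ioc_self

/-- Conditions (A2) and (A3) for the exponentially damped fractional kernel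
`K(u) = C e^{-βu} u^{H-1/2}` with `C, β > 0` and `H ∈ (0,1/2)`: there is a constant
`C' > 0` depending only on `C`, `β` and `H` such that for every horizon `T > 0`, every
measurable `η : [0,T] → [0,T]` with `η(s) ≤ s`, every `t ∈ [0,T)` and `δ ∈ (0, T-t]`:
`∫_t^{t+δ} K(t+δ-η(s))² ds ≤ C' δ^{2H}` and
`∫_0^t |K(t+δ-η(s)) - K(t-η(s))|² ds ≤ C' δ^{2H}`. -/
theorem damped_fractional_kernel_A2_A3
    (C β H : ℝ) (hC : 0 < C) (hβ : 0 < β) (hH : H ∈ Set.Ioo (0:ℝ) (1/2)) :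
    ∃ C' > (0:ℝ), ∀ T > (0:ℝ), ∀ η : ℝ → ℝ, Measurable η →
      (∀ s ∈ Set.Icc (0:ℝ) T, η s ∈ Set.Icc (0:ℝ) T ∧ η s ≤ s) →
      ∀ t ∈ Set.Ico (0:ℝ) T, ∀ δ ∈ Set.Ioc (0:ℝ) (T - t),
        (∫ s in t..(t + δ),
            (C * Real.exp (-β * (t + δ - η s)) * (t + δ - η s) ^ (H - 1/2)) ^ 2)
          ≤ C' * δ ^ (2 * H) ∧
        (∫ s in (0:ℝ)..t,
            (C * Real.exp (-β * (t + δ - η s)) * (t + δ - η s) ^ (H - 1/2)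
              - C * Real.exp (-β * (t - η s)) * (t - η s) ^ (H - 1/2)) ^ 2)
          ≤ C' * δ ^ (2 * H) := by
  obtain ⟨hH0, hH1⟩ := hH
  have ha : H - 1 / 2 ≤ 0 := by linarith
  have ha' : -1 < 2 * (H - 1 / 2) := by linarith
  have hden : 0 < 2 - 2 * H := by linarith
  have he : 2 * (H - 1 / 2) + 1 = 2 * H := by ring
  refine ⟨C ^ 2 * (1 / (2 * H) + 4 / (2 - 2 * H)), by positivity, ?_⟩
  intro T _ η _ hη t ht δ hδ
  obtain ⟨hδ0, hδT⟩ := hδ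
  constructor
  · have hint : IntervalIntegrable
        (fun s => C ^ 2 * (t + δ - s) ^ (2 * (H - 1 / 2))) volume t (t + δ) := by
      have h := ((intervalIntegral.intervalIntegrable_rpow' (a := 0) (b := δ) ha').const_mul
        (C ^ 2)).comp_sub_left (t + δ)
      simpa using h.symm
    have hle := intervalIntegral_le_of_nonneg_of_le (f := fun s =>
        (C * Real.exp (-β * (t + δ - η s)) * (t + δ - η s) ^ (H - 1/2)) ^ 2)
      (by linarith) hint (fun s => sq_nonneg _) (fun s hs => by
        have hs' := (hη s ⟨ht.1.trans hs.1.le, by linarith [hs.2]⟩).2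
        have hv : 0 < t + δ - s := by linarith [hs.2]
        have hu : 0 < t + δ - η s := by linarith
        have hK := damped_rpow_le hC hβ ha hv (by linarith : t + δ - s ≤ t + δ - η s)
        have hp : 0 < (t + δ - η s) ^ (H - 1 / 2) := Real.rpow_pos_of_pos hu _
        rw [← rpow_sq_eq hv, ← mul_pow]
        exact pow_le_pow_left₀ (by positivity) hK 2)
    refine hle.trans ?_
    rw [intervalIntegral.integral_comp_sub_left
      (fun v => C ^ 2 * v ^ (2 * (H - 1 / 2))) (t + δ), sub_self, add_sub_cancel_left,
      integral_const_mul_rpow ha', he]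
    have hp : 0 ≤ C ^ 2 * (4 / (2 - 2 * H)) * δ ^ (2 * H) := by positivity
    calc C ^ 2 * (δ ^ (2 * H) / (2 * H))
        ≤ C ^ 2 * (δ ^ (2 * H) / (2 * H)) + C ^ 2 * (4 / (2 - 2 * H)) * δ ^ (2 * H) := by
          linarith
      _ = _ := by ring
  · have hI := integrable_incrementMajorant (C := C) hδ0 ha ha'
    have hle := intervalIntegral_le_of_nonneg_of_le (f := fun s =>
        (C * Real.exp (-β * (t + δ - η s)) * (t + δ - η s) ^ (H - 1/2)
              - C * Real.exp (-β * (t - η s)) * (t - η s) ^ (H - 1/2)) ^ 2)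
      ht.1 (hI.comp_sub_left t).intervalIntegrable (fun s => sq_nonneg _) (fun s hs => by
        have hs' := (hη s ⟨hs.1.le, hs.2.le.trans ht.2.le⟩).2
        have h := sq_damped_rpow_sub_le_incrementMajorant hC hβ ha (by linarith)
          (by linarith [hs.2] : 0 < t - s) (by linarith : t - s ≤ t - η s) hδ0
        rwa [show t - η s + δ = t + δ - η s by ring] at h)
    refine hle.trans ?_
    rw [intervalIntegral.integral_comp_sub_left (incrementMajorant C (H - 1 / 2) δ) t, sub_self,
      sub_zero, intervalIntegral.integral_of_le ht.1]
    refine (setIntegral_le_integral hI (.of_forall (incrementMajorant_nonneg hδ0))).trans ?_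
    rw [integral_incrementMajorant hδ0 ha ha', he,
      show 1 - 2 * (H - 1 / 2) = 2 - 2 * H by ring]
end
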